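/- arXiv:2205.11672 — 2 statements merged into one kernel-verified Lean document; each statement's English description precedes it below -/
import Mathlib

section
/- Let ν be a probability measure on ℝ invariant under the negation map x ↦ −x, let μ ≥ 0, and let D⁺ and D⁻ be the pushforwards of ν under x ↦ x + μ and x ↦ x − μ respectively. Define wce(θ) = max(D⁺({x : x < θ}), D⁻({x : x > θ})). Then for all real θ, θ' with |θ| ≥ |θ'|, one has wce(θ) ≥ wce(θ'). In particular wce(θ) = wce(−θ) for all θ. -/
open MeasureTheory

/-- Worst-class error of the threshold classifier `x ↦ sign (x - θ)` with
class-conditional distributions `Dpos` (label `+1`) and `Dneg` (label `-1`). -/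
noncomputable def wce (Dpos Dneg : Measure ℝ) (θ : ℝ) : ENNReal :=
  max (Dpos {x | x < θ}) (Dneg {x | θ < x})

/-- The worst-class error for symmetric class-conditionals shifted by `±μ` depends on the
threshold only through its absolute value. -/
theorem wce_map_add_map_sub_eq
    {ν : Measure ℝ} (hsymm : Measure.map (fun x : ℝ => -x) ν = ν) (μ θ : ℝ) :
    wce (Measure.map (fun x => x + μ) ν) (Measure.map (fun x => x - μ) ν) θ
      = ν (Set.Iio (|θ| - μ)) := by
  have hpos : Measure.map (fun x => x + μ) ν (Set.Iio θ) = ν (Set.Iio (θ - μ)) := by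
    rw [Measure.map_apply (by fun_prop) measurableSet_Iio]
    congr 1
    ext x
    simp [lt_sub_iff_add_lt]
  have hneg : Measure.map (fun x => x - μ) ν (Set.Ioi θ) = ν (Set.Iio (-θ - μ)) := by
    rw [Measure.map_apply (by fun_prop) measurableSet_Ioi]
    conv_lhs => rw [← hsymm]
    rw [Measure.map_apply (by fun_prop) (measurableSet_Ioi.preimage (by fun_prop))]
    congr 1
    ext x
    simp only [Set.mem_preimage, Set.mem_Ioi, Set.mem_Iio]
    constructor <;> intro h <;> linarith
  have hmono : Monotone fun t : ℝ => ν (Set.Iio (t - μ)) := fun s t hst =>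
    measure_mono (Set.Iio_subset_Iio (sub_le_sub_right hst μ))
  change max (Measure.map _ ν (Set.Iio θ)) (Measure.map _ ν (Set.Ioi θ)) = _
  rw [hpos, hneg, abs_eq_max_neg]
  exact (hmono.map_max).symm

/-- For class-conditionals obtained by shifting a common symmetric distribution `ν`
to means `+μ` and `-μ`, the worst-class error is monotone in `|θ|`; in particular
it is symmetric, `wce θ = wce (-θ)`. -/
theorem wce_monotone_abs_of_symmetric
    (ν : Measure ℝ) [IsProbabilityMeasure ν]
    (hsymm : Measure.map (fun x : ℝ => -x) ν = ν)
    (μ : ℝ) (hμ : 0 ≤ μ) :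
    (∀ θ θ' : ℝ, |θ'| ≤ |θ| →
        wce (Measure.map (fun x => x + μ) ν) (Measure.map (fun x => x - μ) ν) θ'
          ≤ wce (Measure.map (fun x => x + μ) ν) (Measure.map (fun x => x - μ) ν) θ) ∧
    (∀ θ : ℝ,
        wce (Measure.map (fun x => x + μ) ν) (Measure.map (fun x => x - μ) ν) θ
          = wce (Measure.map (fun x => x + μ) ν) (Measure.map (fun x => x - μ) ν) (-θ)) := by
  simp only [wce_map_add_map_sub_eq hsymm, abs_neg, implies_true, and_true]
  exact fun θ θ' h => measure_mono (Set.Iio_subset_Iio (sub_le_sub_right h μ))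
end

section
/- Define b_t = √(2 log t) − (log log t + log(4π))/√(2 log t) for t > 1. Let β ∈ (0,1) and let n be such that βn ≥ 2 and β⁴·n³ ≥ 1. Then b_{βn} − b_n ≤ −(2·log(1/β))/(3·√(2 log(βn))). -/
open Real

/-- The Fisher–Tippett–Gnedenko centering sequence for the maximum of `t` i.i.d.
standard Gaussians: `b t = √(2 log t) − (log log t + log(4π))/√(2 log t)`. -/
noncomputable def bGauss (t : ℝ) : ℝ :=
  Real.sqrt (2 * Real.log t) -
    (Real.log (Real.log t) + Real.log (4 * π)) / Real.sqrt (2 * Real.log t)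

/-- Monotonicity of `x ↦ (log x + c) / √(2x)`: if `0 < a ≤ b` and `log a + c ≥ 2`, then
`(log b + c) / √(2b) ≤ (log a + c) / √(2a)`. -/
theorem log_add_div_sqrt_le {a b c : ℝ} (ha : 0 < a) (hab : a ≤ b) (hc : 2 ≤ log a + c) :
    (log b + c) / √(2 * b) ≤ (log a + c) / √(2 * a) := by
  have hb : 0 < b := ha.trans_le hab
  have hs : 0 < √(2 * a) := sqrt_pos.2 (by linarith)
  have ht : 0 < √(2 * b) := sqrt_pos.2 (by linarith)
  have hst : √(2 * a) ≤ √(2 * b) := sqrt_le_sqrt (by linarith)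
  have hlog := log_le_sub_one_of_pos (div_pos ht hs)
  rw [log_div ht.ne' hs.ne', log_sqrt (by linarith), log_sqrt (by linarith),
    log_mul two_ne_zero hb.ne', log_mul two_ne_zero ha.ne', le_sub_iff_add_le,
    le_div_iff₀ hs] at hlog
  rw [div_le_div_iff₀ ht hs]
  nlinarith [mul_nonneg (sub_nonneg.2 hc) (sub_nonneg.2 hst)]

/-- A lower bound for increments of `√(2x)` from `a` to `a + L` when `L ≤ 3a`. -/
theorem le_sqrt_sub_sqrt {a L : ℝ} (ha : 0 < a) (hL : 0 ≤ L) (hLa : L ≤ 3 * a) :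
    2 * L / (3 * √(2 * a)) ≤ √(2 * (a + L)) - √(2 * a) := by
  have hs : 0 < √(2 * a) := sqrt_pos.2 (by linarith)
  have hst : √(2 * a) ≤ √(2 * (a + L)) := sqrt_le_sqrt (by linarith)
  have hs2 : √(2 * a) ^ 2 = 2 * a := sq_sqrt (by linarith)
  have ht2 : √(2 * (a + L)) ^ 2 = 2 * (a + L) := sq_sqrt (by linarith)
  have hts : √(2 * (a + L)) ≤ 2 * √(2 * a) :=
    abs_le_of_sq_le_sq' (by nlinarith) (by positivity) |>.2
  rw [div_le_iff₀ (by positivity)]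
  nlinarith [mul_nonneg (sub_nonneg.2 hst) (sub_nonneg.2 hts)]

theorem two_le_log_add_log_four_pi {a : ℝ} (ha : log 2 ≤ a) : 2 ≤ log a + log (4 * π) := by
  have h2 := log_two_gt_d9
  have hπ := pi_gt_d2
  have ha0 : 0 < a := by linarith
  rw [← log_mul ha0.ne' (by positivity), le_log_iff_exp_le (by positivity)]
  have he : exp 2 = exp 1 * exp 1 := by rw [← exp_add]; norm_num
  rw [he]
  nlinarith [exp_one_lt_d9, exp_pos 1]

/-- If `β ∈ (0,1)`, `βn ≥ 2` and `β⁴n³ ≥ 1`, then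
`b_{βn} − b_n ≤ −(2 log(1/β))/(3 √(2 log(βn)))`. -/
theorem bGauss_gap_bound (β : ℝ) (hβ : β ∈ Set.Ioo (0 : ℝ) 1) (n : ℝ)
    (hβn : 2 ≤ β * n) (hβ4n3 : 1 ≤ β ^ 4 * n ^ 3) :
    bGauss (β * n) - bGauss n ≤
      -(2 * Real.log (1 / β)) / (3 * Real.sqrt (2 * Real.log (β * n))) := by
  obtain ⟨hβ0, hβ1⟩ := hβ
  have hn : 0 < n := pos_of_mul_pos_right (by linarith) hβ0.le
  have ha : log 2 ≤ log (β * n) := log_le_log two_pos hβn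
  have ha0 : 0 < log (β * n) := (log_pos one_lt_two).trans_le ha
  have hL : 0 ≤ log (1 / β) := log_nonneg (by rw [le_div_iff₀ hβ0]; linarith)
  have hlogn : log n = log (β * n) + log (1 / β) := by
    rw [log_mul hβ0.ne' hn.ne', one_div, log_inv]; ring
  have hLa : log (1 / β) ≤ 3 * log (β * n) := by
    have h := log_nonneg hβ4n3
    rw [log_mul (by positivity) (by positivity), log_pow, log_pow] at h
    rw [log_mul hβ0.ne' hn.ne', one_div, log_inv]
    push_cast at h
    linarith
  have h1 := le_sqrt_sub_sqrt ha0 hL hLa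
  have h2 := log_add_div_sqrt_le (b := log (β * n) + log (1 / β)) ha0 (by linarith)
    (two_le_log_add_log_four_pi ha)
  unfold bGauss
  rw [hlogn, neg_div]
  linarith
end
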